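/- Let S be a finite thick generalized quadrangle. Assume that for each point p a nontrivial group E(p) of symmetries with center p is given, that there is a prime r dividing |E(p)| for every point p, and set G = ⟨E(p) : p a point⟩. Then the action of G on the point set of S is primitive (in particular transitive, and the only blocks of imprimitivity are the singletons and the full point set). -/

import Mathlib

open Equiv

section GQDefs

variable {P L : Type*}

/-- A generalized quadrangle of order `(s,t)`: every line has `s+1` points, every point is
on `t+1` lines, two distinct points are on at most one common line, and for every
non-incident point-line pair `(p, ℓ)` there is a unique pair `(q, M)` with `M` a line
through `p` and `q` a point incident with both `M` and `ℓ`. -/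
structure IsGQ (I : P → L → Prop) (s t : ℕ) : Prop where
  point_count : ∀ ℓ : L, Nat.card {p : P // I p ℓ} = s + 1
  line_count : ∀ p : P, Nat.card {ℓ : L // I p ℓ} = t + 1
  unique_line : ∀ ⦃p q : P⦄, p ≠ q → ∀ ⦃ℓ m : L⦄, I p ℓ → I q ℓ → I p m → I q m → ℓ = m
  quad : ∀ ⦃p : P⦄ ⦃ℓ : L⦄, ¬ I p ℓ →
    ∃! qM : P × L, I p qM.2 ∧ I qM.1 qM.2 ∧ I qM.1 ℓ

/-- Two points are collinear if some line is incident with both. -/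
def Coll (I : P → L → Prop) (x y : P) : Prop := ∃ ℓ : L, I x ℓ ∧ I y ℓ

/-- The automorphism group of an incidence structure, as a subgroup of
`Perm P × Perm L`: pairs of permutations preserving incidence. -/
def autGroup (I : P → L → Prop) : Subgroup (Perm P × Perm L) where
  carrier := {g | ∀ p ℓ, I (g.1 p) (g.2 ℓ) ↔ I p ℓ}
  one_mem' := fun _ _ => Iff.rfl
  mul_mem' := fun {a b} ha hb p ℓ => (ha (b.1 p) (b.2 ℓ)).trans (hb p ℓ)
  inv_mem' := by
    intro a ha p ℓ
    have h := ha (a⁻¹.1 p) (a⁻¹.2 ℓ)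
    simpa using h.symm

/-- The full group `Ẽ(p)` of symmetries with center `p`: automorphisms fixing every
point collinear with `p`. -/
def symmGroup (I : P → L → Prop) (p : P) : Subgroup (Perm P × Perm L) where
  carrier := {g | g ∈ autGroup I ∧ ∀ y : P, Coll I p y → g.1 y = y}
  one_mem' := ⟨(autGroup I).one_mem, fun _ _ => rfl⟩
  mul_mem' := by
    rintro a b ⟨ha, ha'⟩ ⟨hb, hb'⟩
    refine ⟨(autGroup I).mul_mem ha hb, fun y hy => ?_⟩
    have : (a * b).1 y = a.1 (b.1 y) := rfl
    rw [this, hb' y hy, ha' y hy]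
  inv_mem' := by
    rintro a ⟨ha, ha'⟩
    refine ⟨(autGroup I).inv_mem ha, fun y hy => ?_⟩
    have h : a⁻¹.1 (a.1 y) = y := by simp
    rw [ha' y hy] at h
    exact h

/-- `x^⊥`: the set of points collinear with `x` (including `x` itself). -/
def perpSet (I : P → L → Prop) (x : P) : Set P := {y | Coll I x y}

/-- The hyperbolic line `{x,y}^{⊥⊥}`: points collinear with every point of
`{x,y}^⊥ = x^⊥ ∩ y^⊥`. -/
def hypLine (I : P → L → Prop) (x y : P) : Set P :=
  {z | ∀ w ∈ perpSet I x ∩ perpSet I y, Coll I z w}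

/-- The group `G` generated by all the point-symmetries of the quadrangle. -/
def bigGroup (I : P → L → Prop) : Subgroup (Perm P × Perm L) :=
  ⨆ x : P, symmGroup I x

/-- The set `P_r` of `r`-points: points whose full group of symmetries has order
divisible by `r`. -/
def Pr (I : P → L → Prop) (r : ℕ) : Set P :=
  {y | r ∣ Nat.card (symmGroup I y)}

/-- The set `L_r` of lines incident with at least two points of `P_r`. -/
def Lr (I : P → L → Prop) (r : ℕ) : Set L :=
  {ℓ | ∃ x y : P, x ≠ y ∧ x ∈ Pr I r ∧ y ∈ Pr I r ∧ I x ℓ ∧ I y ℓ}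

/-- The stabilizer `G_u` of a point `u` in a group `G` of automorphisms. -/
def stabPt (G : Subgroup (Perm P × Perm L)) (u : P) : Subgroup (Perm P × Perm L) where
  carrier := {g | g ∈ G ∧ g.1 u = u}
  one_mem' := ⟨G.one_mem, rfl⟩
  mul_mem' := by
    rintro a b ⟨ha, ha'⟩ ⟨hb, hb'⟩
    refine ⟨G.mul_mem ha hb, ?_⟩
    have : (a * b).1 u = a.1 (b.1 u) := rfl
    rw [this, hb', ha']
  inv_mem' := by
    rintro a ⟨ha, ha'⟩
    refine ⟨G.inv_mem ha, ?_⟩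
    have h : a⁻¹.1 (a.1 u) = u := by simp
    rw [ha'] at h
    exact h

/-- The setwise stabilizer `G_ℓ` of a line `ℓ` in a group `G` of automorphisms. -/
def stabLine (G : Subgroup (Perm P × Perm L)) (ℓ : L) : Subgroup (Perm P × Perm L) where
  carrier := {g | g ∈ G ∧ g.2 ℓ = ℓ}
  one_mem' := ⟨G.one_mem, rfl⟩
  mul_mem' := by
    rintro a b ⟨ha, ha'⟩ ⟨hb, hb'⟩
    refine ⟨G.mul_mem ha hb, ?_⟩
    have : (a * b).2 ℓ = a.2 (b.2 ℓ) := rfl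
    rw [this, hb', ha']
  inv_mem' := by
    rintro a ⟨ha, ha'⟩
    refine ⟨G.inv_mem ha, ?_⟩
    have h : a⁻¹.2 (a.2 ℓ) = ℓ := by simp
    rw [ha'] at h
    exact h

/-- Isomorphism of incidence structures: a pair of bijections between the point sets and
the line sets preserving incidence in both directions. -/
def IsoTo {P L P' L' : Type*} (I : P → L → Prop) (I' : P' → L' → Prop) : Prop :=
  ∃ (e : P ≃ P') (f : L ≃ L'), ∀ p ℓ, I' (e p) (f ℓ) ↔ I p ℓ

end GQDefs

section ClassicalGQs

/-- The standard nondegenerate alternating bilinear form on `F^4`. -/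
def sympForm {F : Type*} [Field F] (x y : Fin 4 → F) : F :=
  x 0 * y 1 - x 1 * y 0 + x 2 * y 3 - x 3 * y 2

/-- Points of `W(3,q)`: the `1`-dimensional subspaces of `F_q^4`. -/
def W3Point (F : Type*) [Field F] : Type _ :=
  {W : Submodule F (Fin 4 → F) // Module.finrank F W = 1}

/-- Lines of `W(3,q)`: the `2`-dimensional totally isotropic subspaces of `F_q^4` with
respect to a nondegenerate alternating form. -/
def W3Line (F : Type*) [Field F] : Type _ :=
  {U : Submodule F (Fin 4 → F) //
    Module.finrank F U = 2 ∧ ∀ x ∈ U, ∀ y ∈ U, sympForm x y = 0}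

/-- Incidence in `W(3,q)` is given by inclusion. -/
def W3Incid (F : Type*) [Field F] : W3Point F → W3Line F → Prop :=
  fun W U => W.1 ≤ U.1

/-- The standard nondegenerate Hermitian sesquilinear form on `F_{q²}^4`, relative to the
field automorphism `x ↦ x^q`. -/
def hermForm3 {F : Type*} [Field F] (q : ℕ) (x y : Fin 4 → F) : F :=
  x 0 * y 1 ^ q + x 1 * y 0 ^ q + x 2 * y 3 ^ q + x 3 * y 2 ^ q

/-- The standard nondegenerate Hermitian sesquilinear form on `F_{q²}^5`, relative to the
field automorphism `x ↦ x^q`. -/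
def hermForm4 {F : Type*} [Field F] (q : ℕ) (x y : Fin 5 → F) : F :=
  x 0 * y 1 ^ q + x 1 * y 0 ^ q + x 2 * y 3 ^ q + x 3 * y 2 ^ q + x 4 * y 4 ^ q

/-- Points of `H(3,q²)`: the `1`-dimensional isotropic subspaces of `F_{q²}^4`. -/
def H3Point (F : Type*) [Field F] (q : ℕ) : Type _ :=
  {W : Submodule F (Fin 4 → F) //
    Module.finrank F W = 1 ∧ ∀ x ∈ W, hermForm3 q x x = 0}

/-- Lines of `H(3,q²)`: the `2`-dimensional totally isotropic subspaces of `F_{q²}^4`. -/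
def H3Line (F : Type*) [Field F] (q : ℕ) : Type _ :=
  {U : Submodule F (Fin 4 → F) //
    Module.finrank F U = 2 ∧ ∀ x ∈ U, ∀ y ∈ U, hermForm3 q x y = 0}

/-- Incidence in `H(3,q²)` is given by inclusion. -/
def H3Incid (F : Type*) [Field F] (q : ℕ) : H3Point F q → H3Line F q → Prop :=
  fun W U => W.1 ≤ U.1

/-- Points of `H(4,q²)`: the `1`-dimensional isotropic subspaces of `F_{q²}^5`. -/
def H4Point (F : Type*) [Field F] (q : ℕ) : Type _ :=
  {W : Submodule F (Fin 5 → F) //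
    Module.finrank F W = 1 ∧ ∀ x ∈ W, hermForm4 q x x = 0}

/-- Lines of `H(4,q²)`: the `2`-dimensional totally isotropic subspaces of `F_{q²}^5`. -/
def H4Line (F : Type*) [Field F] (q : ℕ) : Type _ :=
  {U : Submodule F (Fin 5 → F) //
    Module.finrank F U = 2 ∧ ∀ x ∈ U, ∀ y ∈ U, hermForm4 q x y = 0}

/-- Incidence in `H(4,q²)` is given by inclusion. -/
def H4Incid (F : Type*) [Field F] (q : ℕ) : H4Point F q → H4Line F q → Prop :=
  fun W U => W.1 ≤ U.1

end ClassicalGQs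

namespace IsGQ

variable {P L : Type*} {I : P → L → Prop} {s t : ℕ}

theorem exists_other_line (h : IsGQ I s t) (ht : 1 ≤ t) (p : P) (ℓ : L) :
    ∃ m, I p m ∧ m ≠ ℓ := by
  by_contra! hc
  have hsub : {m | I p m} ⊆ ({ℓ} : Set L) := fun m hm => hc m hm
  have h1 := Set.ncard_le_ncard hsub
  have h2 : {m | I p m}.ncard = t + 1 := h.line_count p
  rw [Set.ncard_singleton] at h1
  omega

theorem exists_third_point (h : IsGQ I s t) (hs : 2 ≤ s) (ℓ : L) (a b : P) :
    ∃ x, I x ℓ ∧ x ≠ a ∧ x ≠ b := by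
  by_contra! hc
  have hsub : {x | I x ℓ} ⊆ ({a, b} : Set P) := by
    intro x hx
    by_cases hxa : x = a
    · exact Or.inl hxa
    · exact Or.inr (hc x hx hxa)
  have h1 := Set.ncard_le_ncard hsub
  have h2 : {x | I x ℓ}.ncard = s + 1 := h.point_count ℓ
  have h3 := Set.ncard_insert_le a {b}
  rw [Set.ncard_singleton] at h3
  omega

theorem exists_line (h : IsGQ I s t) (p : P) : ∃ ℓ, I p ℓ := by
  have hpos : 0 < Nat.card {ℓ // I p ℓ} := by rw [h.line_count]; omega
  obtain ⟨ℓ, hℓ⟩ := (Nat.card_pos_iff.1 hpos).1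
  exact ⟨ℓ, hℓ⟩

theorem coll_refl (h : IsGQ I s t) (p : P) : Coll I p p :=
  let ⟨ℓ, hℓ⟩ := h.exists_line p
  ⟨ℓ, hℓ, hℓ⟩

theorem _root_.Coll.symm {x y : P} (h : Coll I x y) : Coll I y x :=
  let ⟨ℓ, hx, hy⟩ := h
  ⟨ℓ, hy, hx⟩

theorem exists_proj (h : IsGQ I s t) (p : P) (ℓ : L) : ∃ q, I q ℓ ∧ Coll I p q := by
  by_cases hp : I p ℓ
  · exact ⟨p, hp, h.coll_refl p⟩
  · obtain ⟨⟨q, M⟩, ⟨h1, h2, h3⟩, -⟩ := h.quad hp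
    exact ⟨q, h3, M, h1, h2⟩

/-- A generalized quadrangle contains no triangles. -/
theorem incident_of_coll (h : IsGQ I s t) {x y z : P} {ℓ : L} (hx : I x ℓ) (hy : I y ℓ)
    (hxy : x ≠ y) (hzx : Coll I z x) (hzy : Coll I z y) : I z ℓ := by
  by_contra hz
  obtain ⟨m, hzm, hxm⟩ := hzx
  obtain ⟨n, hzn, hyn⟩ := hzy
  have := (h.quad hz).unique (y₁ := (x, m)) (y₂ := (y, n)) ⟨hzm, hxm, hx⟩ ⟨hzn, hyn, hy⟩
  exact hxy (congrArg Prod.fst this)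

/-- Any two distinct collinear points have a common non-neighbour. -/
theorem exists_not_coll_both (h : IsGQ I s t) (hs : 2 ≤ s) (ht : 1 ≤ t) {x y : P} {M : L}
    (hx : I x M) (hy : I y M) : ∃ z, ¬ Coll I x z ∧ ¬ Coll I y z := by
  obtain ⟨q, hq, hqx, hqy⟩ := h.exists_third_point hs M x y
  obtain ⟨N, hqN, hNM⟩ := h.exists_other_line ht q M
  obtain ⟨z, hz, hzq, -⟩ := h.exists_third_point hs N q q
  have key : ∀ w, I w M → q ≠ w → ¬ Coll I w z := fun w hw hqw hwz =>
    hNM (h.unique_line hqw hqN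
      (h.incident_of_coll hqN hz hzq.symm ⟨M, hw, hq⟩ hwz) hq hw)
  exact ⟨z, key x hx hqx, key y hy hqy⟩

theorem _root_.coll_map_iff {g : Perm P × Perm L} (hg : g ∈ autGroup I) {x y : P} :
    Coll I (g.1 x) (g.1 y) ↔ Coll I x y := by
  constructor
  · rintro ⟨ℓ, hx, hy⟩
    refine ⟨g.2.symm ℓ, (hg _ _).1 ?_, (hg _ _).1 ?_⟩ <;> simpa
  · rintro ⟨ℓ, hx, hy⟩
    exact ⟨g.2 ℓ, (hg _ _).2 hx, (hg _ _).2 hy⟩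

theorem line_fixed_of_points_fixed (h : IsGQ I s t) {g : Perm P × Perm L}
    (hg : g ∈ autGroup I) {x y : P} (hxy : x ≠ y) (hx : g.1 x = x) (hy : g.1 y = y) {ℓ : L}
    (hxℓ : I x ℓ) (hyℓ : I y ℓ) : g.2 ℓ = ℓ := by
  have h1 := (hg x ℓ).2 hxℓ
  have h2 := (hg y ℓ).2 hyℓ
  rw [hx] at h1
  rw [hy] at h2
  exact h.unique_line hxy h1 h2 hxℓ hyℓ

/-- The line joining a fixed point to its projection on a fixed line is fixed. -/
theorem line_fixed_of_proj (h : IsGQ I s t) {g : Perm P × Perm L} (hg : g ∈ autGroup I)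
    {z q : P} {M N : L} (hzN : ¬ I z N) (hz : g.1 z = z) (hN : g.2 N = N) (hzM : I z M)
    (hqM : I q M) (hqN : I q N) : g.2 M = M := by
  have h1 := (hg z M).2 hzM
  have h2 := (hg q M).2 hqM
  have h3 := (hg q N).2 hqN
  rw [hz] at h1
  rw [hN] at h3
  have := (h.quad hzN).unique (y₁ := (g.1 q, g.2 M)) (y₂ := (q, M)) ⟨h1, h2, h3⟩
    ⟨hzM, hqM, hqN⟩
  exact congrArg Prod.snd this

/-- A symmetry with center `p` that fixes a point not collinear with `p` is trivial. -/
theorem eq_one_of_mem_symmGroup (h : IsGQ I s t) (hs : 2 ≤ s) (ht : 1 ≤ t)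
    {g : Perm P × Perm L} {p y : P} (hg : g ∈ symmGroup I p) (hpy : ¬ Coll I p y)
    (hy : g.1 y = y) : g = 1 := by
  obtain ⟨ha, hfix⟩ := hg
  have line_p : ∀ M, I p M → g.2 M = M := fun M hM => by
    obtain ⟨x, hx, hxp, -⟩ := h.exists_third_point hs M p p
    exact h.line_fixed_of_points_fixed ha hxp (hfix x ⟨M, hM, hx⟩)
      (hfix p (h.coll_refl p)) hx hM
  have line_y : ∀ M, I y M → g.2 M = M := fun M hM => by
    obtain ⟨x, hx, hpx⟩ := h.exists_proj p M
    refine h.line_fixed_of_points_fixed ha ?_ (hfix x hpx) hy hx hM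
    rintro rfl
    exact hpy hpx
  have line_far : ∀ z M, Coll I p z → ¬ Coll I z y → I z M → g.2 M = M := by
    intro z M hpz hzy hM
    obtain ⟨q, hqM, N, hyN, hqN⟩ := h.exists_proj y M
    exact h.line_fixed_of_proj ha (fun hzN => hzy ⟨N, hzN, hyN⟩) (hfix z hpz)
      (line_y N hyN) hM hqM hqN
  have line_near : ∀ z M, Coll I p z → Coll I z y → I z M → g.2 M = M := by
    rintro z M ⟨ℓ, hpℓ, hzℓ⟩ hzy hM
    have hzp : p ≠ z := by rintro rfl; exact hpy hzy
    obtain ⟨m, hpm, hmℓ⟩ := h.exists_other_line ht p ℓ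
    obtain ⟨u, hum, hyu⟩ := h.exists_proj y m
    obtain ⟨w, hwm, hwp, hwu⟩ := h.exists_third_point hs m p u
    have hwy : ¬ Coll I w y := fun hwy =>
      hpy ⟨m, hpm, h.incident_of_coll hwm hum hwu hwy.symm hyu⟩
    have hwz : ¬ Coll I w z := fun hwz =>
      hmℓ (h.unique_line hzp hpm
        (h.incident_of_coll hwm hpm hwp hwz.symm ⟨ℓ, hzℓ, hpℓ⟩) hpℓ hzℓ)
    obtain ⟨q, hqM, N, hwN, hqN⟩ := h.exists_proj w M
    exact h.line_fixed_of_proj ha (fun hzN => hwz ⟨N, hwN, hzN⟩) (hfix z ⟨ℓ, hpℓ, hzℓ⟩)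
      (line_far w N ⟨m, hpm, hwm⟩ hwy hwN) hM hqM hqN
  have lines : ∀ M, g.2 M = M := fun M => by
    obtain ⟨z, hz, hpz⟩ := h.exists_proj p M
    by_cases hzy : Coll I z y
    · exact line_near z M hpz hzy hz
    · exact line_far z M hpz hzy hz
  have points : ∀ w, g.1 w = w := fun w => by
    by_contra hw
    obtain ⟨ℓ, hℓ⟩ := h.exists_line w
    obtain ⟨m, hm, hmℓ⟩ := h.exists_other_line ht w ℓ
    have h1 := (ha w ℓ).2 hℓ
    have h2 := (ha w m).2 hm
    rw [lines] at h1 h2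
    exact hmℓ (h.unique_line hw h2 hm h1 hℓ)
  exact Prod.ext (Equiv.ext points) (Equiv.ext lines)

theorem eq_of_mem_hypLine (h : IsGQ I s t) (ht : 1 ≤ t) {x y z : P} (hxy : ¬ Coll I x y)
    (hz : z ∈ hypLine I x y) (hxz : Coll I x z) : z = x := by
  by_contra hne
  obtain ⟨M, hxM, hzM⟩ := hxz
  obtain ⟨N, hxN, hNM⟩ := h.exists_other_line ht x M
  obtain ⟨u, huN, hyu⟩ := h.exists_proj y N
  have hux : u ≠ x := by rintro rfl; exact hxy hyu.symm
  have hzu : Coll I z u := hz u ⟨⟨N, hxN, huN⟩, hyu⟩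
  exact hNM (h.unique_line hne (h.incident_of_coll huN hxN hux hzu ⟨M, hzM, hxM⟩) hxN hzM hxM)

theorem left_mem_hypLine (x y : P) : x ∈ hypLine I x y := fun _ hw => hw.1

theorem hypLine_comm (x y : P) : hypLine I x y = hypLine I y x := by
  unfold hypLine
  rw [Set.inter_comm]

theorem map_mem_hypLine {g : Perm P × Perm L} {x y z : P} (hg : g ∈ symmGroup I x)
    (hz : z ∈ hypLine I x y) : g.1 z ∈ hypLine I x y := by
  intro w hw
  have hcoll := (coll_map_iff hg.1).2 (hz w hw)
  rwa [hg.2 w hw.1] at hcoll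

/-- If a symmetry of prime order `r` with center `x` stabilizes a subset `X` of the hyperbolic
line through `x` and `y`, then the size of `X` modulo `r` detects whether `x ∈ X`. -/
theorem card_modEq_of_symmetry [Finite P] (h : IsGQ I s t) (hs : 2 ≤ s) (ht : 1 ≤ t)
    {r : ℕ} (hr : r.Prime) {g : Perm P × Perm L} {x y : P} (hxy : ¬ Coll I x y)
    (hg : g ∈ symmGroup I x) (hord : orderOf g = r) {X : Set P} (hX : X ⊆ hypLine I x y)
    (hgX : ∀ z, g.1 z ∈ X ↔ z ∈ X) : X.ncard ≡ (X ∩ {x}).ncard [MOD r] := by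
  classical
  have := Fintype.ofFinite P
  have : Fact r.Prime := ⟨hr⟩
  have hpow : g ^ r = 1 := hord ▸ pow_orderOf_eq_one g
  let f : Perm X := g.1.subtypePerm hgX
  have hf : f ^ r ^ 1 = 1 := by
    rw [pow_one, Perm.subtypePerm_pow]
    ext z
    have h1 : g.1 ^ r = 1 := congrArg Prod.fst hpow
    simp [h1]
  have hfixed : ∀ z ∈ X, g.1 z = z ↔ z = x := by
    intro z hz
    constructor
    · intro hfz
      by_contra hzx
      have hxz : ¬ Coll I x z := fun hc => hzx (h.eq_of_mem_hypLine ht hxy (hX hz) hc)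
      have h1 := h.eq_one_of_mem_symmGroup hs ht hg hxz hfz
      rw [h1, orderOf_one] at hord
      exact hr.one_lt.ne hord
    · rintro rfl
      exact hg.2 z (h.coll_refl z)
  have hmod := Perm.card_compl_support_modEq hf
  have himage : Subtype.val '' (f.supportᶜ : Set X) = X ∩ {x} := by
    ext z
    constructor
    · rintro ⟨⟨w, hw⟩, hfw, rfl⟩
      exact ⟨hw, (hfixed w hw).1 (congrArg Subtype.val (Perm.notMem_support.1 hfw))⟩
    · rintro ⟨hz, hzx⟩
      exact ⟨⟨z, hz⟩, Perm.notMem_support.2 (Subtype.ext ((hfixed z hz).2 hzx)), rfl⟩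
  rw [← himage, Set.ncard_image_of_injective _ Subtype.val_injective, ← Finset.coe_compl,
    Set.ncard_coe_finset, ← Nat.card_coe_set_eq, Nat.card_eq_fintype_card]
  exact hmod.symm

/-- A set of points invariant under the groups `E c`, for `c` in an invariant set `C`, contains
with a point of `C` also each point of `C` not collinear with it. -/
theorem mem_of_not_coll [Finite P] [Finite L] (h : IsGQ I s t) (hs : 2 ≤ s) (ht : 1 ≤ t)
    {E : P → Subgroup (Perm P × Perm L)} (hE : ∀ p, E p ≤ symmGroup I p) {r : ℕ}
    (hr : r.Prime) (hdiv : ∀ p, r ∣ Nat.card (E p)) {C O : Set P}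
    (hC : ∀ c ∈ C, ∀ g ∈ E c, ∀ z ∈ C, g.1 z ∈ C)
    (hO : ∀ c ∈ C, ∀ g ∈ E c, ∀ z ∈ O, g.1 z ∈ O)
    {x y : P} (hx : x ∈ C) (hy : y ∈ C) (hxO : x ∈ O) (hxy : ¬ Coll I x y) : y ∈ O := by
  have : Fact r.Prime := ⟨hr⟩
  by_contra hyO
  have key : ∀ a b, a ∈ C → ¬ Coll I a b → (hypLine I a b ∩ (C ∩ O)).ncard ≡
      ((hypLine I a b ∩ (C ∩ O)) ∩ {a}).ncard [MOD r] := by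
    intro a b ha hab
    obtain ⟨⟨g, hg⟩, hord⟩ := exists_prime_orderOf_dvd_card' r (hdiv a)
    rw [Subgroup.orderOf_mk] at hord
    have hinv : ∀ k ∈ E a, ∀ z ∈ hypLine I a b ∩ (C ∩ O),
        k.1 z ∈ hypLine I a b ∩ (C ∩ O) := fun k hk z hz =>
      ⟨map_mem_hypLine (hE a hk) hz.1, hC a ha k hk z hz.2.1, hO a ha k hk z hz.2.2⟩
    refine h.card_modEq_of_symmetry hs ht hr hab (hE a hg) hord Set.inter_subset_left
      fun z => ⟨fun hz => ?_, hinv g hg z⟩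
    simpa using hinv g⁻¹ (inv_mem hg) _ hz
  have hkx := key x y hx hxy
  have hky := key y x hy fun hc => hxy hc.symm
  rw [hypLine_comm y x] at hky
  have h1 : (hypLine I x y ∩ (C ∩ O)) ∩ {x} = {x} :=
    Set.inter_eq_right.2 (Set.singleton_subset_iff.2 ⟨left_mem_hypLine x y, hx, hxO⟩)
  have h2 : (hypLine I x y ∩ (C ∩ O)) ∩ {y} = ∅ :=
    Set.inter_singleton_eq_empty.2 fun hc => hyO hc.2.2
  rw [h1, Set.ncard_singleton] at hkx
  rw [h2, Set.ncard_empty] at hky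
  have h01 := Nat.modEq_zero_iff_dvd.1 (hkx.symm.trans hky)
  exact hr.one_lt.ne' (Nat.dvd_one.1 h01)

/-- If a set `B` of points contains two distinct points, and each neighbour of a point of `B` that
is not collinear with some point of `B` lies in `B`, then `B` contains all points. -/
theorem eq_univ_of_closed (h : IsGQ I s t) (hs : 2 ≤ s) (ht : 1 ≤ t) {B : Set P}
    (hB : ∀ x ∈ B, ∀ y ∈ B, ∀ z, Coll I x z → ¬ Coll I y z → z ∈ B)
    {a b : P} (ha : a ∈ B) (hb : b ∈ B) (hab : a ≠ b) : B = Set.univ := by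
  obtain ⟨x, hx, y, hy, hxy⟩ : ∃ x ∈ B, ∃ y ∈ B, ¬ Coll I x y := by
    by_cases hc : Coll I a b
    · obtain ⟨M, haM, hbM⟩ := hc
      obtain ⟨N, haN, hNM⟩ := h.exists_other_line ht a M
      obtain ⟨z, hzN, hza, -⟩ := h.exists_third_point hs N a a
      have hbz : ¬ Coll I b z := fun hbz => hNM (h.unique_line hab haN
        (h.incident_of_coll haN hzN hza.symm ⟨M, hbM, haM⟩ hbz) haM hbM)
      exact ⟨b, hb, z, hB a ha b hb z ⟨N, haN, hzN⟩ hbz, hbz⟩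
    · exact ⟨a, ha, b, hb, hc⟩
  have far : ∀ x ∈ B, ∀ y ∈ B, ¬ Coll I x y → ∀ z, Coll I x z →
      ∃ w ∈ B, ¬ Coll I w z := by
    intro x hx y hy hxy z hxz
    by_cases hyz : Coll I y z
    · have hzx : x ≠ z := by rintro rfl; exact hxy hyz.symm
      obtain ⟨M, hxM, hzM⟩ := hxz
      obtain ⟨N, hxN, hNM⟩ := h.exists_other_line ht x M
      obtain ⟨u, huN, hyu⟩ := h.exists_proj y N
      obtain ⟨w, hwN, hwx, hwu⟩ := h.exists_third_point hs N x u
      have hyw : ¬ Coll I y w := fun hyw =>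
        hxy ⟨N, hxN, h.incident_of_coll hwN huN hwu hyw hyu⟩
      refine ⟨w, hB x hx y hy w ⟨N, hxN, hwN⟩ hyw, fun hwz => ?_⟩
      exact hNM (h.unique_line hzx hxN
        (h.incident_of_coll hwN hxN hwx hwz.symm ⟨M, hzM, hxM⟩) hxM hzM)
    · exact ⟨y, hy, hyz⟩
  have perp : ∀ x ∈ B, ∀ y ∈ B, ¬ Coll I x y → ∀ z, Coll I x z → z ∈ B := by
    intro x hx y hy hxy z hxz
    obtain ⟨w, hw, hwz⟩ := far x hx y hy hxy z hxz
    exact hB x hx w hw z hxz hwz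
  refine Set.eq_univ_of_forall fun z => ?_
  obtain ⟨ℓ, hzℓ⟩ := h.exists_line z
  obtain ⟨q, hqℓ, hxq⟩ := h.exists_proj x ℓ
  have hq := perp x hx y hy hxy q hxq
  obtain ⟨w, hw, hwq⟩ := far x hx y hy hxy q hxq
  exact perp q hq w hw (fun hc => hwq hc.symm) z ⟨ℓ, hqℓ, hzℓ⟩

end IsGQ

/-- The group `G` generated by nontrivial symmetry groups `E(p)` (all of order divisible
by the prime `r`) acts primitively on the point set: it is transitive, and every block of
imprimitivity is a singleton or the whole point set. -/
theorem G_primitive_on_points {P L : Type} [Finite P] [Finite L]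
    (I : P → L → Prop) (s t : ℕ) (hGQ : IsGQ I s t) (hs : 2 ≤ s) (ht : 2 ≤ t)
    (E : P → Subgroup (Equiv.Perm P × Equiv.Perm L))
    (hEsym : ∀ p : P, E p ≤ symmGroup I p) (hEnt : ∀ p : P, E p ≠ ⊥)
    (r : ℕ) (hr : r.Prime) (hdiv : ∀ p : P, r ∣ Nat.card (E p)) :
    (∀ x y : P, ∃ g ∈ (⨆ p : P, E p : Subgroup (Equiv.Perm P × Equiv.Perm L)), g.1 x = y) ∧
    (∀ B : Set P, B.Nonempty →
      (∀ g ∈ (⨆ p : P, E p : Subgroup (Equiv.Perm P × Equiv.Perm L)),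
        ⇑g.1 '' B = B ∨ Disjoint (⇑g.1 '' B) B) →
      (∃ x : P, B = {x}) ∨ B = Set.univ) := by
  have ht1 : 1 ≤ t := by omega
  constructor
  · intro x y
    let G : Subgroup (Equiv.Perm P × Equiv.Perm L) := ⨆ p : P, E p
    let O : Set P := {z | ∃ g ∈ G, g.1 x = z}
    have hO : ∀ c ∈ Set.univ, ∀ g ∈ E c, ∀ z ∈ O, g.1 z ∈ O := by
      rintro c - g hg z ⟨k, hk, rfl⟩
      exact ⟨g * k, mul_mem (le_iSup E c hg) hk, rfl⟩
    have step : ∀ u v, u ∈ O → ¬ Coll I u v → v ∈ O := fun u v hu huv =>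
      hGQ.mem_of_not_coll hs ht1 hEsym hr hdiv (C := Set.univ) (fun _ _ _ _ _ _ => trivial)
        hO trivial trivial hu huv
    have hx : x ∈ O := ⟨1, one_mem G, rfl⟩
    by_cases hxy : Coll I x y
    · obtain ⟨M, hxM, hyM⟩ := hxy
      obtain ⟨z, hxz, hyz⟩ := hGQ.exists_not_coll_both hs ht1 hxM hyM
      exact step z y (step x z hx hxz) fun hc => hyz hc.symm
    · exact step x y hx hxy
  · rintro B ⟨b, hb⟩ hblock
    by_cases hsing : ∃ a ∈ B, a ≠ b
    · obtain ⟨a, ha, hab⟩ := hsing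
      right
      let C : Set P := {z | ∃ x ∈ B, Coll I x z}
      have hBC : B ⊆ C := fun x hx => ⟨x, hx, hGQ.coll_refl x⟩
      have hBinv : ∀ c ∈ C, ∀ g ∈ E c, ∀ z ∈ B, g.1 z ∈ B := by
        rintro c ⟨x, hx, hxc⟩ g hg z hz
        rcases hblock g (le_iSup E c hg) with heq | hdisj
        · rw [← heq]
          exact Set.mem_image_of_mem _ hz
        · have hgx : g.1 x = x := (hEsym c hg).2 x hxc.symm
          exact (Set.disjoint_left.1 hdisj ⟨x, hx, hgx⟩ hx).elim
      have hCinv : ∀ c ∈ C, ∀ g ∈ E c, ∀ z ∈ C, g.1 z ∈ C := by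
        rintro c hc g hg z ⟨x, hx, hxz⟩
        exact ⟨g.1 x, hBinv c hc g hg x hx, (coll_map_iff (hEsym c hg).1).2 hxz⟩
      refine hGQ.eq_univ_of_closed hs ht1 ?_ ha hb hab
      intro x hx y hy z hxz hyz
      exact hGQ.mem_of_not_coll hs ht1 hEsym hr hdiv hCinv hBinv (hBC hy) ⟨x, hx, hxz⟩ hy hyz
    · left
      push Not at hsing
      exact ⟨b, Set.eq_singleton_iff_unique_mem.2 ⟨hb, hsing⟩⟩
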